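/- arXiv:math/0510060 — 4 statements merged into one kernel-verified Lean document; each statement's English description precedes it below -/
import Mathlib

section
/- Let p be a prime and n a natural number. The Glaisher map γ, which sends a p-regular partition λ = (λ_1, …, λ_ℓ) of n to the partition obtained by writing each part λ_i = p^{a_i} q_i with p ∤ q_i and replacing λ_i by p^{a_i} copies of q_i, is a well-defined bijection from the set of p-regular partitions of n onto the set of p-class regular partitions of n. -/
/-- The multiset-level Glaisher map: each part `a = p ^ v * q` with `p ∤ q`
is replaced by `p ^ v` copies of `q`. -/
def glaisherParts (p : ℕ) (s : Multiset ℕ) : Multiset ℕ :=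
  s.bind fun a =>
    Multiset.replicate (p ^ (a.factorization p)) (a / p ^ (a.factorization p))

/-- A partition is `p`-regular if no part occurs `p` (or more) times. -/
def IsPRegular (p : ℕ) {n : ℕ} (lam : n.Partition) : Prop :=
  ∀ a : ℕ, lam.parts.count a < p

/-- A partition is `p`-class regular if no part is divisible by `p`. -/
def IsPClassRegular (p : ℕ) {n : ℕ} (mu : n.Partition) : Prop :=
  ∀ a ∈ mu.parts, ¬ p ∣ a

theorem glaisherParts_add (p : ℕ) (s t : Multiset ℕ) :
    glaisherParts p (s + t) = glaisherParts p s + glaisherParts p t :=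
  Multiset.add_bind _ _ _

theorem sum_glaisherParts (p : ℕ) (s : Multiset ℕ) : (glaisherParts p s).sum = s.sum := by
  simp [glaisherParts, Multiset.sum_bind, Nat.ordProj_mul_ordCompl_eq_self]

theorem exists_of_mem_glaisherParts {p q : ℕ} {s : Multiset ℕ} (h : q ∈ glaisherParts p s) :
    ∃ a ∈ s, q = a / p ^ a.factorization p := by
  obtain ⟨a, ha, hq⟩ := Multiset.mem_bind.mp h
  exact ⟨a, ha, Multiset.eq_of_mem_replicate hq⟩

theorem glaisherParts_eq_self {p : ℕ} {s : Multiset ℕ} (h : ∀ a ∈ s, ¬ p ∣ a) :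
    glaisherParts p s = s := by
  calc glaisherParts p s = s.bind fun a => {a} :=
        Multiset.bind_congr fun a ha => by
          simp [Nat.factorization_eq_zero_of_not_dvd (h a ha), Multiset.replicate_one]
    _ = s := (Multiset.bind_singleton s id).trans (Multiset.map_id s)

/-- Merging `p` copies of a part `a` into a single part `p * a` does not change the image under
the Glaisher map. -/
theorem glaisherParts_replicate {p a : ℕ} (hp : p.Prime) (ha : a ≠ 0) :
    glaisherParts p (Multiset.replicate p a) = glaisherParts p {p * a} := by
  have hv : (p * a).factorization p = a.factorization p + 1 := by
    rw [Nat.factorization_mul hp.ne_zero ha]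
    simp [hp.factorization_self, add_comm]
  have hq : p * a / p ^ (a.factorization p + 1) = a / p ^ a.factorization p := by
    rw [pow_succ', Nat.mul_div_mul_left _ _ hp.pos]
  rw [glaisherParts, glaisherParts, Multiset.singleton_bind, hv, hq, pow_succ',
    Multiset.bind, Multiset.map_replicate, Multiset.join, Multiset.sum_replicate,
    Multiset.nsmul_replicate]

theorem exists_glaisherParts_eq {p : ℕ} (hp : p.Prime) (s : Multiset ℕ) (hs : ∀ a ∈ s, 0 < a) :
    ∃ t : Multiset ℕ, (∀ a ∈ t, 0 < a) ∧ (∀ a, t.count a < p) ∧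
      glaisherParts p t = glaisherParts p s := by
  induction hn : s.card using Nat.strong_induction_on generalizing s with
  | _ n ih =>
    subst hn
    by_cases h : ∀ a, s.count a < p
    · exact ⟨s, hs, h, rfl⟩
    · push Not at h
      obtain ⟨a, ha⟩ := h
      obtain ⟨u, rfl⟩ := Multiset.le_iff_exists_add.mp (Multiset.le_count_iff_replicate_le.mp ha)
      have ha0 : 0 < a := hs a (by simp [Multiset.mem_replicate, hp.ne_zero])
      obtain ⟨t, ht, htc, hts⟩ := ih ({p * a} + u).card (by simp; have := hp.one_lt; omega)
        ({p * a} + u) (by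
          intro b hb
          rcases Multiset.mem_add.mp hb with hb | hb
          · rw [Multiset.mem_singleton.mp hb]
            exact Nat.mul_pos hp.pos ha0
          · exact hs b (Multiset.mem_add.mpr (.inr hb))) rfl
      refine ⟨t, ht, htc, hts.trans ?_⟩
      rw [glaisherParts_add, glaisherParts_add, glaisherParts_replicate hp ha0.ne']

theorem card_isPRegular_eq_card_isPClassRegular {p : ℕ} (hp : 0 < p) (n : ℕ) :
    Nat.card {lam : n.Partition // IsPRegular p lam} =
      Nat.card {mu : n.Partition // IsPClassRegular p mu} := by
  classical
  have h := Nat.Partition.card_restricted_eq_card_countRestricted n hp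
  rw [Nat.Partition.restricted, Nat.Partition.countRestricted] at h
  rw [Nat.card_eq_fintype_card, Nat.card_eq_fintype_card, Fintype.card_subtype,
    Fintype.card_subtype]
  convert h.symm using 3 with lam
  · refine ⟨fun h a _ => h a, fun h a => ?_⟩
    by_cases ha : a ∈ lam.parts
    · exact h a ha
    · rwa [Multiset.count_eq_zero_of_notMem ha]
  · exact Iff.rfl

/-- The Glaisher map is a well-defined bijection from the `p`-regular
partitions of `n` onto the `p`-class regular partitions of `n`. -/
theorem glaisher_well_defined_bijection (p n : ℕ) (hp : p.Prime) :
    ∃ f : {lam : n.Partition // IsPRegular p lam} →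
        {mu : n.Partition // IsPClassRegular p mu},
      (∀ lam, (f lam).1.parts = glaisherParts p lam.1.parts) ∧
        Function.Bijective f := by
  refine ⟨fun lam => ⟨⟨glaisherParts p lam.1.parts, ?_, ?_⟩, ?_⟩, fun _ => rfl, ?_⟩
  · intro q hq
    obtain ⟨a, ha, rfl⟩ := exists_of_mem_glaisherParts hq
    exact Nat.ordCompl_pos p (lam.1.parts_pos ha).ne'
  · rw [sum_glaisherParts, lam.1.parts_sum]
  · intro q hq
    obtain ⟨a, ha, rfl⟩ := exists_of_mem_glaisherParts hq
    exact Nat.not_dvd_ordCompl hp (lam.1.parts_pos ha).ne'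
  · refine Function.Surjective.bijective_of_nat_card_le ?_
      (card_isPRegular_eq_card_isPClassRegular hp.pos n).le
    rintro ⟨mu, hmu⟩
    obtain ⟨t, ht, htc, hts⟩ := exists_glaisherParts_eq hp mu.parts fun _ => mu.parts_pos
    rw [glaisherParts_eq_self hmu] at hts
    refine ⟨⟨⟨t, fun {a} => ht a, ?_⟩, htc⟩, Subtype.ext (Nat.Partition.ext hts)⟩
    rw [← sum_glaisherParts p, hts, mu.parts_sum]
end

section
/- Let p be a prime, let λ be a p-regular partition of n, and let μ = γ(λ) be its image under the Glaisher map. Let x be a permutation in the symmetric group S_n whose cycle type is μ. Then the p-part of the order of the centralizer of x in S_n equals p^{(ℓ(μ) − ℓ(λ))/(p−1)}; that is, the p-adic valuation of |Z_{S_n}(x)| is (ℓ(μ) − ℓ(λ))/(p−1). -/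
open Finset in
/-- The size of a centralizer in a symmetric group, in terms of the full cycle type
(fixed points included). -/
theorem Equiv.Perm.nat_card_centralizer_eq_partition {α : Type*} [Fintype α] [DecidableEq α]
    (g : Equiv.Perm α) :
    Nat.card (Subgroup.centralizer ({g} : Set (Equiv.Perm α))) =
      g.partition.parts.prod *
        ∏ a ∈ g.partition.parts.toFinset, (g.partition.parts.count a).factorial := by
  classical
  rw [Equiv.Perm.nat_card_centralizer, Equiv.Perm.parts_partition, Equiv.Perm.sum_cycleType]
  generalize Fintype.card α - #g.support = f
  have h1 : (1 : ℕ) ∉ g.cycleType := fun h ↦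
    absurd (Equiv.Perm.one_lt_of_mem_cycleType h) (lt_irrefl 1)
  have hsub : (g.cycleType + Multiset.replicate f 1).toFinset ⊆
      insert 1 g.cycleType.toFinset := by
    intro a ha
    simp only [Multiset.mem_toFinset, Multiset.mem_add, Multiset.mem_replicate,
      Finset.mem_insert] at ha ⊢
    tauto
  rw [Finset.prod_subset hsub, Finset.prod_insert (by simpa using h1)]
  · have h2 : ∏ a ∈ g.cycleType.toFinset,
        ((g.cycleType + Multiset.replicate f 1).count a).factorial =
        ∏ a ∈ g.cycleType.toFinset, (g.cycleType.count a).factorial := by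
      refine Finset.prod_congr rfl fun a ha ↦ ?_
      have : 1 ≠ a := by rintro rfl; exact h1 (by simpa using ha)
      simp [Multiset.count_replicate, this]
    rw [h2]
    simp [Multiset.count_eq_zero_of_notMem h1]
    ring
  · intro a _ ha
    rw [Multiset.mem_toFinset] at ha
    rw [Multiset.count_eq_zero_of_notMem ha, Nat.factorial_zero]

/-- Legendre's formula for a number given by its base `p` expansion. -/
theorem Nat.Prime.sub_one_mul_factorization_factorial_sum_add_sum {p : ℕ} (hp : p.Prime)
    (N : ℕ) (c : ℕ → ℕ) (hc : ∀ i, c i < p) :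
    (p - 1) * (∑ i ∈ Finset.range N, c i * p ^ i).factorial.factorization p
      + ∑ i ∈ Finset.range N, c i = ∑ i ∈ Finset.range N, c i * p ^ i := by
  have := Fact.mk hp
  induction N generalizing c with
  | zero => simp
  | succ N ih =>
    have h := ih (fun i ↦ c (i + 1)) fun i ↦ hc _
    have hs : ∑ i ∈ Finset.range (N + 1), c i * p ^ i =
        p * ∑ i ∈ Finset.range N, c (i + 1) * p ^ i + c 0 := by
      rw [Finset.sum_range_succ', Finset.mul_sum]
      congr 1
      · exact Finset.sum_congr rfl fun i _ ↦ by ring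
      · simp
    rw [hs, Finset.sum_range_succ']
    generalize ∑ i ∈ Finset.range N, c (i + 1) * p ^ i = m at *
    rw [Nat.factorization_def _ hp] at h ⊢
    rw [padicValNat_factorial_mul_add _ (hc 0), padicValNat_factorial_mul]
    obtain ⟨k, rfl⟩ : ∃ k, p = k + 1 := ⟨p - 1, by have := hp.pos; omega⟩
    simp only [Nat.add_sub_cancel] at h ⊢
    linear_combination h

/-- Summing over the elements with given prime-to-`p` part `q` amounts to summing over the
`p ^ i * q`. -/
theorem Finset.sum_filter_ordCompl_eq {p q N : ℕ} (hp : p.Prime) (hq : ¬ p ∣ q) (s : Finset ℕ)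
    (hs : ∀ a ∈ s, a ≠ 0 ∧ a < N) (f : ℕ → ℕ → ℕ) (hf : ∀ a ∉ s, ∀ i, f a i = 0) :
    ∑ a ∈ s with a / p ^ a.factorization p = q, f a (a.factorization p) =
      ∑ i ∈ Finset.range N, f (p ^ i * q) i := by
  have hq0 : q ≠ 0 := by rintro rfl; exact hq (dvd_zero p)
  have hfac (i : ℕ) : (p ^ i * q).factorization p = i := by
    rw [Nat.factorization_mul (pow_ne_zero _ hp.ne_zero) hq0, Finsupp.add_apply,
      hp.factorization_pow, Nat.factorization_eq_zero_of_not_dvd hq]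
    simp
  refine Finset.sum_of_injOn (fun a ↦ a.factorization p) ?_ ?_ ?_ ?_
  · intro a ha b hb hab
    simp only [Finset.coe_filter, Set.mem_ofPred_eq] at ha hb hab
    rw [← Nat.ordProj_mul_ordCompl_eq_self a p, ← Nat.ordProj_mul_ordCompl_eq_self b p,
      ha.2, hb.2, hab]
  · intro a ha
    simp only [Finset.coe_filter, Set.mem_ofPred_eq] at ha
    obtain ⟨h0, hN⟩ := hs a ha.1
    simpa using (Nat.factorization_lt p h0).trans hN
  · intro i _ hi
    refine hf _ (fun hmem ↦ hi ⟨p ^ i * q, ?_, hfac i⟩) _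
    simp [hmem, hfac, hp.pos]
  · intro a ha
    have h := Nat.ordProj_mul_ordCompl_eq_self a p
    rw [(Finset.mem_filter.1 ha).2] at h
    simp only [h]

theorem count_glaisherParts (p q : ℕ) (s : Multiset ℕ) :
    (glaisherParts p s).count q =
      ∑ a ∈ s.toFinset with a / p ^ a.factorization p = q,
        s.count a * p ^ a.factorization p := by
  rw [glaisherParts, Multiset.count_bind, Finset.sum_multiset_map_count, Finset.sum_filter]
  refine Finset.sum_congr rfl fun a _ ↦ ?_
  rw [Multiset.count_replicate]
  split_ifs <;> simp

theorem mem_glaisherParts {p q : ℕ} (hp : p.Prime) {s : Multiset ℕ} :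
    q ∈ glaisherParts p s ↔ ∃ a ∈ s, a / p ^ a.factorization p = q := by
  simp [glaisherParts, Multiset.mem_bind, Multiset.mem_replicate, hp.ne_zero, eq_comm]

theorem not_dvd_of_mem_glaisherParts {p q : ℕ} (hp : p.Prime) {s : Multiset ℕ} (hs : 0 ∉ s)
    (hq : q ∈ glaisherParts p s) : ¬ p ∣ q := by
  obtain ⟨a, ha, rfl⟩ := (mem_glaisherParts hp).1 hq
  exact Nat.not_dvd_ordCompl hp fun h ↦ hs (h ▸ ha)

theorem sub_one_mul_sum_factorization_count_glaisherParts {p : ℕ} (hp : p.Prime)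
    {s : Multiset ℕ} (hs : 0 ∉ s) (hc : ∀ a, s.count a < p) :
    (p - 1) * ∑ q ∈ (glaisherParts p s).toFinset,
        ((glaisherParts p s).count q).factorial.factorization p + s.card =
      (glaisherParts p s).card := by
  have hcard : s.card = ∑ q ∈ (glaisherParts p s).toFinset,
      ∑ a ∈ s.toFinset with a / p ^ a.factorization p = q, s.count a := by
    rw [Finset.sum_fiberwise_of_maps_to, Multiset.toFinset_sum_count_eq]
    intro a ha
    rw [Multiset.mem_toFinset] at ha ⊢
    exact (mem_glaisherParts hp).2 ⟨a, ha, rfl⟩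
  rw [hcard, ← Multiset.toFinset_sum_count_eq (glaisherParts p s), Finset.mul_sum,
    ← Finset.sum_add_distrib]
  refine Finset.sum_congr rfl fun q hq ↦ ?_
  have hpq := not_dvd_of_mem_glaisherParts hp hs (Multiset.mem_toFinset.1 hq)
  have hbd : ∀ a ∈ s.toFinset, a ≠ 0 ∧ a < s.sum + 1 := fun a ha ↦ by
    rw [Multiset.mem_toFinset] at ha
    exact ⟨fun h ↦ hs (h ▸ ha), Nat.lt_succ_of_le (Multiset.le_sum_of_mem ha)⟩
  have hzero : ∀ a ∉ s.toFinset, s.count a = 0 := fun a ha ↦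
    Multiset.count_eq_zero_of_notMem fun h ↦ ha (Multiset.mem_toFinset.2 h)
  rw [count_glaisherParts,
    Finset.sum_filter_ordCompl_eq hp hpq _ hbd (fun a i ↦ s.count a * p ^ i)
      fun a ha i ↦ by simp [hzero a ha],
    Finset.sum_filter_ordCompl_eq hp hpq _ hbd (fun a _ ↦ s.count a) fun a ha _ ↦ hzero a ha]
  exact hp.sub_one_mul_factorization_factorial_sum_add_sum _ _ fun i ↦ hc _

/-- Let `λ` be a `p`-regular partition of `n` and `μ = γ(λ)` its Glaisher image.
If `x ∈ S_n` has cycle type `μ`, then the `p`-adic valuation of the order of the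
centralizer `Z_{S_n}(x)` equals `(ℓ(μ) − ℓ(λ)) / (p − 1)`; equivalently, the
`p`-part of `|Z_{S_n}(x)|` is `p ^ ((ℓ(μ) − ℓ(λ)) / (p − 1))`. -/
theorem centralizer_p_part_of_glaisher (p n : ℕ) (hp : p.Prime)
    (lam : n.Partition) (h : IsPRegular p lam)
    (x : Equiv.Perm (Fin n))
    (hx : (Equiv.Perm.partition x).parts = glaisherParts p lam.parts) :
    (Nat.card (Subgroup.centralizer ({x} : Set (Equiv.Perm (Fin n))))).factorization p
      = (Multiset.card (glaisherParts p lam.parts) - Multiset.card lam.parts) / (p - 1) := by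
  have h0 : 0 ∉ lam.parts := fun h ↦ absurd (lam.parts_pos h) (lt_irrefl 0)
  have hprod : ¬ p ∣ (glaisherParts p lam.parts).prod := by
    intro hdvd
    obtain ⟨q, hq, hpq⟩ := hp.prime.exists_mem_multiset_dvd hdvd
    exact not_dvd_of_mem_glaisherParts hp h0 hq hpq
  have hne : (glaisherParts p lam.parts).prod ≠ 0 := fun h ↦ hprod (h ▸ dvd_zero p)
  rw [Equiv.Perm.nat_card_centralizer_eq_partition, hx,
    Nat.factorization_mul hne (Finset.prod_ne_zero_iff.2 fun _ _ ↦ Nat.factorial_ne_zero _),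
    Nat.factorization_prod fun _ _ ↦ Nat.factorial_ne_zero _, Finsupp.add_apply,
    Nat.factorization_eq_zero_of_not_dvd hprod, zero_add, Finsupp.finsetSum_apply,
    ← sub_one_mul_sum_factorization_count_glaisherParts hp h0 h, Nat.add_sub_cancel,
    Nat.mul_div_cancel_left _ (Nat.sub_pos_of_lt hp.one_lt)]
end

section
/- Let p be a prime, let λ be a p-regular partition of n, and let μ = γ(λ) be its image under the Glaisher map, with m_k denoting the multiplicity of k as a part of μ. Then Σ_k v_p(m_k!) = (ℓ(μ) − ℓ(λ))/(p−1), where v_p(m!) = Σ_{i≥1} ⌊m/p^i⌋ is the p-adic valuation of m!. -/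
/-- Legendre's formula for a number written in base `p` with the given digits. -/
theorem sub_one_mul_factorization_factorial_sum_range {p : ℕ} (hp : p.Prime) (N : ℕ) (f : ℕ → ℕ)
    (hf : ∀ i, f i < p) :
    (p - 1) * (∑ i ∈ Finset.range N, f i * p ^ i).factorial.factorization p
      + ∑ i ∈ Finset.range N, f i = ∑ i ∈ Finset.range N, f i * p ^ i := by
  have : Fact p.Prime := ⟨hp⟩
  have hdigits : ∀ (N : ℕ) (f : ℕ → ℕ), (∀ i, f i < p) →
      (p.digits (∑ i ∈ Finset.range N, f i * p ^ i)).sum = ∑ i ∈ Finset.range N, f i := by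
    intro N
    induction N with
    | zero => simp
    | succ N ih =>
      intro f hf
      have hstep : ∑ i ∈ Finset.range (N + 1), f i * p ^ i
          = f 0 + p * ∑ i ∈ Finset.range N, f (i + 1) * p ^ i := by
        rw [Finset.sum_range_succ', Finset.mul_sum, add_comm]
        simp [pow_succ', mul_left_comm]
      rw [hstep, Finset.sum_range_succ', ← ih (fun i => f (i + 1)) fun i => hf _]
      generalize ∑ i ∈ Finset.range N, f (i + 1) * p ^ i = m
      by_cases h : f 0 = 0 ∧ m = 0
      · simp [h.1, h.2]
      · rw [Nat.digits_add p hp.one_lt _ _ (hf 0) (by tauto), List.sum_cons, add_comm]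
  have hle := Nat.digit_sum_le p (∑ i ∈ Finset.range N, f i * p ^ i)
  rw [Nat.factorization_def _ hp, sub_one_mul_padicValNat_factorial, ← hdigits N f hf]
  exact Nat.sub_add_cancel hle

/-- Legendre's formula for a sum of powers of `p`, no power occurring `p` or more times. -/
theorem sub_one_mul_factorization_factorial_sum_pow {p : ℕ} (hp : p.Prime) (s : Multiset ℕ)
    (hs : ∀ i, s.count i < p) :
    (p - 1) * (s.map (p ^ ·)).sum.factorial.factorization p + Multiset.card s
      = (s.map (p ^ ·)).sum := by
  obtain ⟨N, hN⟩ := s.toFinset.exists_nat_subset_range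
  have hsum : (s.map (p ^ ·)).sum = ∑ i ∈ Finset.range N, s.count i * p ^ i := by
    rw [Finset.sum_multiset_map_count]
    refine Finset.sum_subset hN fun i _ hi => ?_
    simp [Multiset.count_eq_zero_of_notMem (fun h => hi (Multiset.mem_toFinset.2 h))]
  have hcard : Multiset.card s = ∑ i ∈ Finset.range N, s.count i :=
    (Multiset.sum_count_eq_card fun a ha => hN (Multiset.mem_toFinset.2 ha)).symm
  rw [hsum, hcard]
  exact sub_one_mul_factorization_factorial_sum_range hp N _ hs

theorem count_glaisherParts_s5 (p k : ℕ) (s : Multiset ℕ) :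
    (glaisherParts p s).count k
      = (((s.filter fun a => k = a / p ^ a.factorization p).map fun a =>
          a.factorization p).map (p ^ ·)).sum := by
  induction s using Multiset.induction_on with
  | empty => simp [glaisherParts]
  | cons a s ih =>
    rw [glaisherParts, Multiset.cons_bind, Multiset.count_add, ← glaisherParts, ih,
      Multiset.count_replicate]
    by_cases h : k = a / p ^ a.factorization p
    · rw [Multiset.filter_cons_of_pos (p := fun a => k = a / p ^ a.factorization p) s h]
      simp [h.symm]
    · rw [Multiset.filter_cons_of_neg (p := fun a => k = a / p ^ a.factorization p) s h,
        if_neg (Ne.symm h), zero_add]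

theorem sum_card_filter_eq_card {p : ℕ} (hp : p.Prime) (s : Multiset ℕ) :
    ∑ k ∈ (glaisherParts p s).toFinset,
      Multiset.card (s.filter fun a => k = a / p ^ a.factorization p) = Multiset.card s := by
  rw [← Multiset.card_map (fun a => a / p ^ a.factorization p) s]
  simp_rw [← Multiset.count_map]
  refine Multiset.sum_count_eq_card fun k hk => ?_
  obtain ⟨a, ha, rfl⟩ := Multiset.mem_map.1 hk
  rw [Multiset.mem_toFinset, glaisherParts, Multiset.mem_bind]
  exact ⟨a, ha, Multiset.mem_replicate.2 ⟨(pow_pos hp.pos _).ne', rfl⟩⟩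

theorem count_factorization_filter_le (p k i : ℕ) (s : Multiset ℕ) :
    ((s.filter fun a => k = a / p ^ a.factorization p).map fun a => a.factorization p).count i
      ≤ s.count (p ^ i * k) := by
  rw [Multiset.count_map, Multiset.filter_filter, Multiset.count, Multiset.countP_eq_card_filter]
  refine Multiset.card_le_card (Multiset.monotone_filter_right s ?_)
  rintro a ⟨rfl, rfl⟩
  exact Nat.ordProj_mul_ordCompl_eq_self a p

/-- Let `λ` be a `p`-regular partition of `n` and `μ = γ(λ)` its Glaisher
image, with `m_k` the multiplicity of `k` as a part of `μ`.  Then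
`Σ_k v_p(m_k!) = (ℓ(μ) − ℓ(λ)) / (p − 1)`, where `v_p(m!) = Σ_{i ≥ 1} ⌊m/pⁱ⌋`
is the `p`-adic valuation of `m!` (Legendre's formula). -/
theorem sum_factorial_valuation_eq (p n : ℕ) (hp : p.Prime)
    (lam : n.Partition) (h : IsPRegular p lam) :
    ∑ k ∈ (glaisherParts p lam.parts).toFinset,
        (((glaisherParts p lam.parts).count k).factorial).factorization p
      = (Multiset.card (glaisherParts p lam.parts) - Multiset.card lam.parts) / (p - 1) := by
  set μ := glaisherParts p lam.parts
  have hkey : (p - 1) * ∑ k ∈ μ.toFinset, (μ.count k).factorial.factorization p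
      + Multiset.card lam.parts = Multiset.card μ := by
    rw [← sum_card_filter_eq_card hp lam.parts, Finset.mul_sum, ← Finset.sum_add_distrib,
      ← Multiset.toFinset_sum_count_eq μ]
    refine Finset.sum_congr rfl fun k _ => ?_
    have hk := sub_one_mul_factorization_factorial_sum_pow hp
      ((lam.parts.filter fun a => k = a / p ^ a.factorization p).map fun a => a.factorization p)
      fun i => (count_factorization_filter_le p k i lam.parts).trans_lt (h _)
    rwa [← count_glaisherParts_s5, Multiset.card_map] at hk
  rw [← hkey, Nat.add_sub_cancel, Nat.mul_div_cancel_left _ (Nat.sub_pos_of_lt hp.one_lt)]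
end

section
/- Let p(n) denote the number of partitions of n and q(n) the number of partitions of n into odd parts (equivalently, into distinct parts). Then p(n) = Σ_{k=0}^{n} q(k) · p((n−k)/2), where the term p((n−k)/2) is interpreted as 0 when n − k is odd. -/
namespace Nat.Partition

/-- The partition of `n = k + 2 * m` consisting of the parts of a partition of `k` together with
the doubled parts of a partition of `m`. -/
def addDouble {n k m : ℕ} (h : k + 2 * m = n) (a : k.Partition) (b : m.Partition) :
    n.Partition where
  parts := a.parts + b.parts.map (2 * ·)
  parts_pos {i} hi := by
    rcases Multiset.mem_add.1 hi with hi | hi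
    · exact a.parts_pos hi
    · obtain ⟨j, hj, rfl⟩ := Multiset.mem_map.1 hi
      exact Nat.mul_pos two_pos (b.parts_pos hj)
  parts_sum := by
    rw [Multiset.sum_add, Multiset.sum_map_mul_left, Multiset.map_id', a.parts_sum, b.parts_sum, h]

theorem mem_odds {k : ℕ} {a : k.Partition} : a ∈ odds k ↔ ∀ i ∈ a.parts, ¬ Even i := by
  simp [odds, restricted]

theorem filter_not_even_addDouble {n k m : ℕ} (h : k + 2 * m = n) {a : k.Partition}
    (ha : a ∈ odds k) (b : m.Partition) :
    (addDouble h a b).parts.filter (¬ Even ·) = a.parts := by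
  rw [addDouble, Multiset.filter_add, Multiset.filter_eq_self.2 (mem_odds.1 ha),
    Multiset.filter_eq_nil.2, add_zero]
  simp

/-- The sum of the odd parts and the sum of the even parts of a partition of `n` add up to `n`. -/
theorem sum_filter_not_even_add_sum_filter_even {n : ℕ} (p : n.Partition) :
    (p.parts.filter (¬ Even ·)).sum + (p.parts.filter (Even ·)).sum = n := by
  rw [← Multiset.sum_add, add_comm, Multiset.filter_add_not, p.parts_sum]

theorem exists_addDouble_eq {n k m : ℕ} (h : k + 2 * m = n) (p : n.Partition)
    (hp : (p.parts.filter (¬ Even ·)).sum = k) :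
    ∃ a ∈ odds k, ∃ b, addDouble h a b = p := by
  have hmap : ((p.parts.filter (Even ·)).map (· / 2)).map (2 * ·) = p.parts.filter (Even ·) := by
    rw [Multiset.map_map]
    refine (Multiset.map_congr rfl fun i hi ↦ ?_).trans (Multiset.map_id _)
    exact Nat.two_mul_div_two_of_even (Multiset.of_mem_filter hi)
  refine ⟨⟨p.parts.filter (¬ Even ·), fun hi ↦ p.parts_pos (Multiset.mem_of_mem_filter hi), hp⟩,
    mem_odds.2 fun i hi ↦ (Multiset.mem_filter.1 hi).2,
    ⟨(p.parts.filter (Even ·)).map (· / 2), ?_, ?_⟩, ?_⟩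
  · intro i hi
    obtain ⟨j, hj, rfl⟩ := Multiset.mem_map.1 hi
    obtain ⟨hj, hjeven⟩ := Multiset.mem_filter.1 hj
    exact Nat.div_pos (Nat.le_of_dvd (p.parts_pos hj) hjeven.two_dvd) two_pos
  · have hsum := congrArg Multiset.sum hmap
    rw [Multiset.sum_map_mul_left, Multiset.map_id'] at hsum
    have := p.sum_filter_not_even_add_sum_filter_even
    lia
  · ext1
    change p.parts.filter (¬ Even ·) +
      ((p.parts.filter (Even ·)).map (· / 2)).map (2 * ·) = p.parts
    rw [hmap, add_comm, Multiset.filter_add_not]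

/-- Partitions of `n = k + 2 * m` whose odd parts sum to `k` are counted by pairs consisting of a
partition of `k` into odd parts and a partition of `m`. -/
theorem card_filter_sum_odd_parts {n k m : ℕ} (h : k + 2 * m = n) :
    (Finset.univ.filter fun p : n.Partition ↦ (p.parts.filter (¬ Even ·)).sum = k).card =
      (odds k).card * Fintype.card m.Partition := by
  rw [← Finset.card_univ, ← Finset.card_product]
  symm
  refine Finset.card_bij (fun x _ ↦ addDouble h x.1 x.2) ?_ ?_ ?_
  · rintro ⟨a, b⟩ hab
    rw [Finset.mem_filter, filter_not_even_addDouble h (Finset.mem_product.1 hab).1]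
    exact ⟨Finset.mem_univ _, a.parts_sum⟩
  · rintro ⟨a, b⟩ hab ⟨c, d⟩ hcd heq
    obtain rfl : a = c := by
      ext1
      rw [← filter_not_even_addDouble h (Finset.mem_product.1 hab).1 b,
        ← filter_not_even_addDouble h (Finset.mem_product.1 hcd).1 d, heq]
    have hparts := add_left_cancel (congrArg parts heq)
    have hinj : Function.Injective (2 * · : ℕ → ℕ) := mul_right_injective₀ two_ne_zero
    exact Prod.ext rfl (Partition.ext (Multiset.map_injective hinj hparts))
  · intro p hp
    obtain ⟨a, ha, b, hab⟩ := exists_addDouble_eq h p (Finset.mem_filter.1 hp).2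
    exact ⟨(a, b), Finset.mem_product.2 ⟨ha, Finset.mem_univ _⟩, hab⟩

end Nat.Partition

/-- Euler-type recursion: with `p(n)` the number of partitions of `n` and
`q(k)` the number of partitions of `k` into odd parts (equivalently, into
distinct parts), one has `p(n) = Σ_{k=0}^{n} q(k)·p((n−k)/2)`, where the term
`p((n−k)/2)` is interpreted as `0` when `n − k` is odd. -/
theorem card_partition_eq_sum_odd_card_mul (n : ℕ) :
    Fintype.card n.Partition
      = ∑ k ∈ Finset.range (n + 1),
          (Nat.Partition.odds k).card *
            (if 2 ∣ (n - k) then Fintype.card ((n - k) / 2).Partition else 0) := by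
  have hmaps : ∀ p ∈ (Finset.univ : Finset n.Partition),
      (p.parts.filter (¬ Even ·)).sum ∈ Finset.range (n + 1) := fun p _ ↦ by
    have := p.sum_filter_not_even_add_sum_filter_even
    rw [Finset.mem_range]
    lia
  rw [← Finset.card_univ, Finset.card_eq_sum_card_fiberwise hmaps]
  refine Finset.sum_congr rfl fun k hk ↦ ?_
  rw [Finset.mem_range] at hk
  split_ifs with hdvd
  · exact Nat.Partition.card_filter_sum_odd_parts (by lia)
  · rw [mul_zero, Finset.card_eq_zero, Finset.filter_eq_empty_iff]
    intro p _ hp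
    have hsum := p.sum_filter_not_even_add_sum_filter_even
    have heven : 2 ∣ (p.parts.filter (Even ·)).sum :=
      Multiset.dvd_sum fun i hi ↦ (Multiset.of_mem_filter hi).two_dvd
    lia
end
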